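/- The quiver Γ together with the translation τ_Γ is a stable translation quiver: Γ has no loops and no multiple arrows, and for any two vertices v, w of Γ there is an arrow v → w if and only if there is an arrow τ_Γ(w) → v. -/

import Mathlib

/-- The number of vertices `|δ_{a,b}|` on the counterclockwise boundary path from `a` to `b`
(including both endpoints); `|δ_{a,a}| = n + 1`. -/
def deltaLen {n : ℕ} (a b : ZMod n) : ℕ :=
  if a = b then n + 1 else (b - a).val + 1

/-- A tagged edge `M_{a,b}^ε` of the punctured polygon with `n` vertices:
`a, b` are vertices with `|δ_{a,b}| ≥ 3`, `ε ∈ {+1, -1}` (an element of `ℤˣ`),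
and `ε = 1` whenever `a ≠ b`. -/
structure TaggedEdge (n : ℕ) where
  a : ZMod n
  b : ZMod n
  ε : ℤˣ
  tag_eq_one : a ≠ b → ε = 1
  three_le : 3 ≤ deltaLen a b

/-- The translation `τ`: `τ M_{a,b} = M_{a-1,b-1}` for `a ≠ b`, and
`τ M_{a,a}^ε = M_{a-1,a-1}^{-ε}`. -/
def tau {n : ℕ} (M : TaggedEdge n) : TaggedEdge n where
  a := M.a - 1
  b := M.b - 1
  ε := if M.a = M.b then -M.ε else M.ε
  tag_eq_one := by
    intro h
    have hab : M.a ≠ M.b := by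
      intro he; exact h (by rw [he])
    rw [if_neg hab]
    exact M.tag_eq_one hab
  three_le := by
    by_cases hab : M.a = M.b
    · have h1 : M.a - 1 = M.b - 1 := by rw [hab]
      have h3 := M.three_le
      unfold deltaLen at h3 ⊢
      rw [if_pos h1]
      rwa [if_pos hab] at h3
    · have h1 : M.a - 1 ≠ M.b - 1 := by
        intro he
        apply hab
        have h2 := congrArg (fun x => x + 1) he
        simpa using h2
      have h2 : M.b - 1 - (M.a - 1) = M.b - M.a := by ring
      have h3 := M.three_le
      unfold deltaLen at h3 ⊢
      rw [if_neg h1, h2]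
      rwa [if_neg hab] at h3

/-- The loop tagged edge `M_{a,a}^{-ε}` obtained from a loop `M_{a,a}^ε` by changing the tag. -/
def negLoop {n : ℕ} (M : TaggedEdge n) (h : M.a = M.b) : TaggedEdge n where
  a := M.a
  b := M.b
  ε := -M.ε
  tag_eq_one := fun hab => absurd h hab
  three_le := M.three_le

/-- `x` lies on the closed counterclockwise boundary interval `[u,v]`. -/
def memCC {n : ℕ} (x u v : ZMod n) : Prop := (x - u).val ≤ (v - u).val

/-- `x` lies on the open counterclockwise boundary interval `]u,v[`. -/
def memOO {n : ℕ} (x u v : ZMod n) : Prop := memCC x u v ∧ x ≠ u ∧ x ≠ v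

open Classical in
/-- The crossing number `e(M,N)` of two tagged edges. -/
noncomputable def crossNum {n : ℕ} (M N : TaggedEdge n) : ℕ :=
  if M.a = M.b then
    (if N.a = N.b then
      (if M.a ≠ N.a ∧ M.ε ≠ N.ε then 1 else 0)
    else
      (if memOO M.a N.a N.b then 1 else 0))
  else
    (if N.a = N.b then
      (if memOO N.a M.a M.b then 1 else 0)
    else
      (if memOO N.a (M.a + 1) M.b ∧ memOO N.b M.a N.a then 2
       else if (memCC N.a (M.a + 1) (M.b - 1) ∧ memCC N.b (M.b + 1) M.a) ∨
               (memCC N.a M.b (M.a - 1) ∧ memCC N.b (M.a + 1) (M.b - 1)) then 1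
       else 0))

/-- There is an elementary move `M ↦ N`. -/
def Move {n : ℕ} (M N : TaggedEdge n) : Prop :=
  (M.a ≠ M.b ∧ 3 ≤ deltaLen M.a M.b ∧ deltaLen M.a M.b ≤ n - 1 ∧
    N.a = M.a ∧ N.b = M.b + 1) ∨
  (M.a ≠ M.b ∧ 4 ≤ deltaLen M.a M.b ∧ deltaLen M.a M.b ≤ n ∧
    N.a = M.a + 1 ∧ N.b = M.b) ∨
  (M.a ≠ M.b ∧ deltaLen M.a M.b = n ∧ N.a = M.a ∧ N.b = M.a) ∨
  (M.a = M.b ∧ N.a = M.a + 1 ∧ N.b = M.a)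

/-- A triangulation: a maximal set of pairwise non-crossing tagged edges. -/
def IsTriangulation {n : ℕ} (T : Set (TaggedEdge n)) : Prop :=
  (∀ M ∈ T, ∀ N ∈ T, crossNum M N = 0) ∧
  (∀ T' : Set (TaggedEdge n), (∀ M ∈ T', ∀ N ∈ T', crossNum M N = 0) → T ⊆ T' → T' = T)

/-- The fan triangulation `T(a₁) = {M_{a₁,a₁}^{+1}, M_{a₁,a₁}^{-1}} ∪
{M_{a₁, a₁+k-1} : 3 ≤ k ≤ n}`. -/
def fan {n : ℕ} (a₁ : ZMod n) : Set (TaggedEdge n) :=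
  {M | M.a = a₁ ∧ (M.b = a₁ ∨ ∃ k : ℕ, 3 ≤ k ∧ k ≤ n ∧ M.b = a₁ + (k : ZMod n) - 1)}

open Classical in
/-- The translation `τ_Γ` of the translation quiver `Γ`. -/
noncomputable def tauGamma {n : ℕ} (a₁ : ZMod n) (v : ℤ × TaggedEdge n) :
    ℤ × TaggedEdge n :=
  if v.2 ∈ fan a₁ then (v.1 - 1, tau v.2) else (v.1, tau v.2)

/-- The arrows of the quiver `Γ` with vertex set `ℤ × (tagged edges)`. -/
def GammaArrow {n : ℕ} (a₁ : ZMod n) (v w : ℤ × TaggedEdge n) : Prop :=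
  (Move v.2 w.2 ∧ (w.2 ∉ fan a₁ ∨ (v.2 ∈ fan a₁ ∧ w.2 ∈ fan a₁)) ∧ w.1 = v.1) ∨
  (Move v.2 w.2 ∧ w.2 ∈ fan a₁ ∧ v.2 ∉ fan a₁ ∧ w.1 = v.1 + 1)

theorem deltaLen_eq_iff {n : ℕ} (hn : 3 ≤ n) (a b : ZMod n) {l : ℕ} (h2 : 2 ≤ l)
    (hl : l ≤ n + 1) : deltaLen a b = l ↔ b = a + (l : ZMod n) - 1 := by
  have : NeZero n := ⟨by omega⟩
  unfold deltaLen
  obtain ⟨k, rfl⟩ : ∃ k, l = k + 1 := ⟨l - 1, by omega⟩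
  have hb : b = a + ((k + 1 : ℕ) : ZMod n) - 1 ↔ b - a = (k : ZMod n) := by
    push_cast
    constructor <;> intro h
    · rw [h]; ring
    · rw [← h]; ring
  rw [hb]
  have hval := ZMod.val_lt (b - a)
  rcases (show k < n ∨ k = n by omega) with hk | rfl
  · have hval_k : (k : ZMod n).val = k := ZMod.val_cast_of_lt hk
    split_ifs with hab
    · subst hab
      refine iff_of_false (by omega) fun h => ?_
      rw [sub_self] at h
      rw [← h, ZMod.val_zero] at hval_k
      omega
    · rw [Nat.add_right_cancel_iff]
      constructor
      · intro h
        rw [← h, ZMod.natCast_zmod_val]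
      · intro h
        rw [h, hval_k]
  · rw [ZMod.natCast_self, sub_eq_zero]
    split_ifs with hab
    · simp [hab]
    · exact iff_of_false (by omega) (Ne.symm hab)

theorem deltaLen_le {n : ℕ} (hn : 3 ≤ n) (a b : ZMod n) : deltaLen a b ≤ n + 1 := by
  have : NeZero n := ⟨by omega⟩
  have := ZMod.val_lt (b - a)
  unfold deltaLen
  split_ifs <;> omega

theorem deltaLen_eq_succ_iff {n : ℕ} (hn : 3 ≤ n) (a b : ZMod n) :
    deltaLen a b = n + 1 ↔ a = b := by
  rw [deltaLen_eq_iff hn a b (by omega) le_rfl]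
  simp [eq_comm]

theorem deltaLen_sub_one {n : ℕ} (a b : ZMod n) :
    deltaLen (a - 1) (b - 1) = deltaLen a b := by
  simp [deltaLen]

/-- An elementary move either lengthens the boundary path at its end or shortens it at its
start. -/
theorem move_iff {n : ℕ} (hn : 3 ≤ n) (M N : TaggedEdge n) :
    Move M N ↔
      (N.a = M.a ∧ deltaLen N.a N.b = deltaLen M.a M.b + 1) ∨
      (N.a = M.a + 1 ∧ deltaLen M.a M.b = deltaLen N.a N.b + 1) := by
  have hM := M.three_le
  have hN := N.three_le
  have hM' := deltaLen_le hn M.a M.b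
  have hN' := deltaLen_le hn N.a N.b
  have hMb := (deltaLen_eq_iff hn M.a M.b (by omega) hM').1 rfl
  have hNb := (deltaLen_eq_iff hn N.a N.b (by omega) hN').1 rfl
  have hloop := deltaLen_eq_succ_iff hn M.a M.b
  unfold Move
  generalize hl : deltaLen M.a M.b = l at *
  generalize hm : deltaLen N.a N.b = m at *
  constructor
  · rintro (⟨-, -, h, ha, hb⟩ | ⟨-, h, h', ha, hb⟩ | ⟨-, h, ha, hb⟩ | ⟨h, ha, hb⟩)
    · refine Or.inl ⟨ha, ?_⟩
      rw [← hm, deltaLen_eq_iff hn _ _ (by omega) (by omega), hb, hMb, ha]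
      push_cast
      ring
    · refine Or.inr ⟨ha, ?_⟩
      suffices m = l - 1 by omega
      rw [← hm, deltaLen_eq_iff hn _ _ (by omega) (by omega), hb, hMb, ha]
      push_cast [show 1 ≤ l by omega]
      ring
    · refine Or.inl ⟨ha, ?_⟩
      rw [← hm, h, deltaLen_eq_succ_iff hn, ha, hb]
    · refine Or.inr ⟨ha, ?_⟩
      rw [hloop.2 h, ← hm, Nat.add_right_cancel_iff, eq_comm,
        deltaLen_eq_iff hn _ _ (by omega) (by omega), ha, hb]
      simp
  · rintro (⟨ha, h⟩ | ⟨ha, h⟩)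
    · have hne : M.a ≠ M.b := fun he => by have := hloop.2 he; omega
      rcases (show l ≤ n - 1 ∨ l = n by omega) with hl' | hl'
      · refine Or.inl ⟨hne, hM, hl', ha, ?_⟩
        rw [hNb, hMb, ha, h]
        push_cast
        ring
      · refine Or.inr (Or.inr (Or.inl ⟨hne, hl', ha, ?_⟩))
        rw [hNb, ha, h, hl']
        simp
    · rcases (show l ≤ n ∨ l = n + 1 by omega) with hl' | hl'
      · have hne : M.a ≠ M.b := fun he => by have := hloop.2 he; omega
        refine Or.inr (Or.inl ⟨hne, by omega, hl', ha, ?_⟩)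
        rw [hNb, hMb, ha, h]
        push_cast
        ring
      · refine Or.inr (Or.inr (Or.inr ⟨hloop.1 hl', ha, ?_⟩))
        rw [hNb, ha, show m = n by omega]
        simp

theorem move_tau_iff {n : ℕ} (hn : 3 ≤ n) (M N : TaggedEdge n) :
    Move (tau N) M ↔ Move M N := by
  rw [move_iff hn, move_iff hn]
  simp only [tau, deltaLen_sub_one, sub_add_cancel, eq_sub_iff_add_eq]
  rw [or_comm, eq_comm (a := M.a), eq_comm (a := M.a + 1)]

theorem Move.a_eq {n : ℕ} (hn : 3 ≤ n) {M N : TaggedEdge n} (h : Move M N) :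
    N.a = M.a ∨ N.a = M.a + 1 :=
  ((move_iff hn M N).1 h).imp And.left And.left

theorem mem_fan_iff {n : ℕ} (hn : 3 ≤ n) (a₁ : ZMod n) (M : TaggedEdge n) :
    M ∈ fan a₁ ↔ M.a = a₁ := by
  refine ⟨And.left, fun h => ⟨h, ?_⟩⟩
  have hM := M.three_le
  have hM' := deltaLen_le hn M.a M.b
  have hMb := (deltaLen_eq_iff hn M.a M.b (by omega) hM').1 rfl
  by_cases hl : deltaLen M.a M.b = n + 1
  · exact Or.inl (((deltaLen_eq_succ_iff hn _ _).1 hl).symm.trans h)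
  · refine Or.inr ⟨_, hM, by omega, ?_⟩
    rw [← h]
    exact hMb

/-- `(Γ, τ_Γ)` is a stable translation quiver: `Γ` has no loops (arrows are given by
a `Prop`-valued relation, so there are no multiple arrows), and there is an arrow `v → w` iff
there is an arrow `τ_Γ(w) → v`. -/
theorem gamma_stable_translation_quiver (n : ℕ) (hn : 3 ≤ n) (a₁ : ZMod n) :
    (∀ v : ℤ × TaggedEdge n, ¬ GammaArrow a₁ v v) ∧
    (∀ v w : ℤ × TaggedEdge n,
      GammaArrow a₁ v w ↔ GammaArrow a₁ (tauGamma a₁ w) v) := by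
  have : Fact (1 < n) := ⟨by omega⟩
  refine ⟨fun v h => ?_, ?_⟩
  · have hv : Move v.2 v.2 := by
      rcases h with h | h <;> exact h.1
    rcases (move_iff hn _ _).1 hv with h | h <;> omega
  · rintro ⟨i, M⟩ ⟨j, N⟩
    have hone : a₁ - 1 ≠ a₁ := by simp
    have hone' : N.a = a₁ + 1 → N.a - 1 = a₁ := fun h => by rw [h]; ring
    unfold GammaArrow tauGamma
    simp only [mem_fan_iff hn]
    by_cases hmove : Move M N
    · have hmove' := (move_tau_iff hn M N).2 hmove
      have hτ : (tau N).a = N.a - 1 := rfl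
      by_cases hNa : N.a = a₁
      · have hτa : (tau N).a ≠ a₁ := by rw [hτ, hNa]; exact hone
        by_cases hMa : M.a = a₁ <;> simp [hmove, hmove', hNa, hMa, hτa] <;> omega
      · by_cases hMa : M.a = a₁
        · have hτa : (tau N).a = a₁ := by
            rcases hmove.a_eq hn with h | h
            · exact absurd (h.trans hMa) hNa
            · rw [hτ]; exact hone' (by rw [h, hMa])
          simp [hmove, hmove', hNa, hMa, hτa, eq_comm]
        · simp [hmove, hmove', hNa, hMa, eq_comm]
    · have hmove' : ¬ Move (tau N) M := fun h => hmove ((move_tau_iff hn M N).1 h)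
      by_cases hNa : N.a = a₁ <;> simp [hmove, hmove', hNa]
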